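/- Let (X,d) be an (R,D)-thin metric space, let α : [0,L_α] → X be a 1-Lipschitz (e.g. unit-speed) curve, and let l : [0,L] → X be a segment with L > 2R. Let t, u ∈ (R, L−R) with t < u. If l(t) ∈ π_l(α(0)) and l(u) ∈ π_l(α(L_α)), then the set π_l(α([0,L_α])) contains a 3D-net of either l([t,u]) or of the union l([R,t]) ∪ l([u, L−R]). -/

import Mathlib

open Metric Set

/-- `l` restricted to `[a, b]` is a unit-speed segment (isometric embedding of `[a,b]`). -/
def IsSegmentOn {X : Type*} [PseudoMetricSpace X] (l : ℝ → X) (a b : ℝ) : Prop :=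
  ∀ s ∈ Set.Icc a b, ∀ t ∈ Set.Icc a b, dist (l s) (l t) = |s - t|

/-- A ray in `X`: an isometric embedding of `[0, ∞)`. -/
def IsRay {X : Type*} [PseudoMetricSpace X] (r : ℝ → X) : Prop :=
  ∀ s t : ℝ, 0 ≤ s → 0 ≤ t → dist (r s) (r t) = |s - t|

/-- `X` is a geodesic space: any two points are joined by a segment. -/
def IsGeodesicSpace (X : Type*) [PseudoMetricSpace X] : Prop :=
  ∀ x y : X, ∃ f : ℝ → X, IsSegmentOn f 0 (dist x y) ∧ f 0 = x ∧ f (dist x y) = y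

/-- The metric projection of a point `x` to a set `K`:
the set of points of `K` realizing the distance from `x` to `K`. -/
def metricProj {X : Type*} [PseudoMetricSpace X] (K : Set X) (x : X) : Set X :=
  {y ∈ K | dist x y = Metric.infDist x K}

/-- The metric projection of a set `A` to a set `K`. -/
def metricProjSet {X : Type*} [PseudoMetricSpace X] (K A : Set X) : Set X :=
  ⋃ x ∈ A, metricProj K x

/-- `S` contains a `c`-net of `T`: every point of `T` is within distance `c` of `S`. -/
def ContainsNetOf {X : Type*} [PseudoMetricSpace X] (S T : Set X) (c : ℝ) : Prop :=
  ∀ p ∈ T, ∃ q ∈ S, dist p q ≤ c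

/-- An `(R,D)`-thin metric space: a proper, separable, geodesic metric space
(with `R ≥ 20 D > 0`) such that for every segment `l` of length `L > 2R`, every
`t ∈ (R, L - R)` and every `x` whose projection to `l` meets `l(t)`, one has
`dist(x, l) < D`. -/
structure IsThinSpace (X : Type*) [MetricSpace X] (R D : ℝ) : Prop where
  R_pos : 0 < R
  D_pos : 0 < D
  twentyD_le_R : 20 * D ≤ R
  proper : ProperSpace X
  separable : TopologicalSpace.SeparableSpace X
  geodesic : IsGeodesicSpace X
  thin : ∀ (l : ℝ → X) (L : ℝ), 2 * R < L → IsSegmentOn l 0 L →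
    ∀ t ∈ Set.Ioo R (L - R), ∀ x : X,
      dist x (l t) = Metric.infDist x (l '' Set.Icc 0 L) →
      Metric.infDist x (l '' Set.Icc 0 L) < D

lemma IsSegmentOn.continuousOn {X : Type*} [PseudoMetricSpace X] {l : ℝ → X} {a b : ℝ}
    (hl : IsSegmentOn l a b) : ContinuousOn l (Icc a b) :=
  (LipschitzOnWith.of_dist_le_mul (K := 1) fun x hx y hy => by
    rw [hl x hx y hy, Real.dist_eq, NNReal.coe_one, one_mul]).continuousOn

/-- If `M ⊆ K` is nonempty and compact, a point has a projection to `K` lying in `M` as soon as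
it is as close to `M` as to `K`. -/
lemma IsCompact.exists_mem_metricProj {X : Type*} [PseudoMetricSpace X] {K M : Set X}
    (hM : IsCompact M) (hne : M.Nonempty) (hMK : M ⊆ K) {x : X}
    (hx : infDist x M ≤ infDist x K) : ∃ y ∈ M, y ∈ metricProj K x := by
  obtain ⟨y, hy, hxy⟩ := hM.exists_infDist_eq_dist hne x
  exact ⟨y, hy, hMK hy, (hxy ▸ hx).antisymm (infDist_le_dist_of_mem (hMK hy))⟩

/-- If a preconnected set projects into the union of two compact subsets `M`, `N` of `K` and meets
the projections of both, some point of it has projections in both `M` and `N`. -/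
lemma IsPreconnected.exists_metricProj_mem_both {X : Type*} [PseudoMetricSpace X]
    {S K M N : Set X} (hS : IsPreconnected S) (hK : IsCompact K) (hM : IsCompact M)
    (hN : IsCompact N) (hMK : M ⊆ K) (hNK : N ⊆ K) (hMN : metricProjSet K S ⊆ M ∪ N)
    {x y m n : X} (hx : x ∈ S) (hy : y ∈ S) (hm : m ∈ M) (hn : n ∈ N)
    (hxm : m ∈ metricProj K x) (hyn : n ∈ metricProj K y) :
    ∃ z ∈ S, (∃ p ∈ M, p ∈ metricProj K z) ∧ ∃ q ∈ N, q ∈ metricProj K z := by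
  have closed : ∀ T : Set X, IsClosed {z | infDist z T ≤ infDist z K} := fun T =>
    isClosed_le (continuous_infDist_pt T) (continuous_infDist_pt K)
  have close : ∀ {T : Set X} {z p : X}, p ∈ T → p ∈ metricProj K z →
      infDist z T ≤ infDist z K := fun hp hzp =>
    (infDist_le_dist_of_mem hp).trans hzp.2.le
  obtain ⟨z, hz, hzM, hzN⟩ := isPreconnected_closed_iff.1 hS _ _ (closed M) (closed N)
    (fun z hz => by
      obtain ⟨p, -, hp⟩ := hK.exists_mem_metricProj ⟨m, hMK hm⟩ Subset.rfl (le_refl (infDist z K))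
      exact (hMN (mem_biUnion hz hp)).imp (close · hp) (close · hp))
    ⟨x, hx, close hm hxm⟩ ⟨y, hy, close hn hyn⟩
  exact ⟨z, hz, hM.exists_mem_metricProj ⟨m, hm⟩ hMK hzM,
    hN.exists_mem_metricProj ⟨n, hn⟩ hNK hzN⟩

/-- In a thin space, the projections of a preconnected set to a segment cannot jump both into and
out of an interval `[a, b]` while staying away from its endpoints. -/
lemma IsThinSpace.exists_dist_metricProjSet_le {X : Type*} [MetricSpace X] {R D : ℝ}
    (hX : IsThinSpace X R D) {S : Set X} (hS : IsPreconnected S) {l : ℝ → X} {L : ℝ}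
    (hL : 2 * R < L) (hl : IsSegmentOn l 0 L) {a b : ℝ} (ha : R ≤ a) (hb : b ≤ L - R)
    {x y : X} (hx : x ∈ S) (hy : y ∈ S) {p q : ℝ} (hp : p ∈ Icc a b) (hq : q ∈ Icc 0 L)
    (hqab : q ∉ Ioo a b) (hxp : l p ∈ metricProj (l '' Icc 0 L) x)
    (hyq : l q ∈ metricProj (l '' Icc 0 L) y) :
    ∃ z ∈ metricProjSet (l '' Icc 0 L) S, dist (l a) z ≤ 3 * D ∨ dist (l b) z ≤ 3 * D := by
  by_contra! hfar
  have hR := hX.R_pos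
  have hD := hX.D_pos
  have hab := hp.1.trans hp.2
  have haL : a ∈ Icc 0 L := ⟨by linarith, by linarith⟩
  have hbL : b ∈ Icc 0 L := ⟨by linarith, by linarith⟩
  have hpL : p ∈ Icc 0 L := ⟨haL.1.trans hp.1, hp.2.trans hbL.2⟩
  have far : ∀ {z : X} {r : ℝ}, z ∈ S → r ∈ Icc 0 L → l r ∈ metricProj (l '' Icc 0 L) z →
      3 * D < |a - r| ∧ 3 * D < |b - r| := fun {z r} hz hr hzr => by
    rw [← hl a haL r hr, ← hl b hbL r hr]
    exact hfar _ (mem_biUnion hz hzr)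
  have inside : ∀ {z : X} {r : ℝ}, z ∈ S → r ∈ Icc 0 L → l r ∈ metricProj (l '' Icc 0 L) z →
      r ∈ Icc a b → r ∈ Icc (a + 3 * D) (b - 3 * D) := fun {z r} hz hr hzr hrab => by
    have h := far hz hr hzr
    rw [abs_of_nonpos (by linarith [hrab.1]), abs_of_nonneg (by linarith [hrab.2])] at h
    exact ⟨by linarith, by linarith⟩
  have outside : ∀ {z : X} {r : ℝ}, z ∈ S → r ∈ Icc 0 L → l r ∈ metricProj (l '' Icc 0 L) z →
      r ∉ Ioo a b → r ∈ Icc 0 (a - 3 * D) ∪ Icc (b + 3 * D) L := fun {z r} hz hr hzr hrab => by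
    have h := far hz hr hzr
    rcases le_or_gt r a with hra | hra
    · rw [abs_of_nonneg (by linarith : 0 ≤ a - r)] at h
      exact Or.inl ⟨hr.1, by linarith⟩
    · have hrb : b ≤ r := not_lt.1 fun hrb => hrab ⟨hra, hrb⟩
      rw [abs_of_nonpos (by linarith : b - r ≤ 0)] at h
      exact Or.inr ⟨by linarith, hr.2⟩
  have hMsub : Icc (a + 3 * D) (b - 3 * D) ⊆ Icc 0 L :=
    Icc_subset_Icc (by linarith) (by linarith)
  have hNsub : Icc 0 (a - 3 * D) ∪ Icc (b + 3 * D) L ⊆ Icc 0 L :=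
    union_subset (Icc_subset_Icc le_rfl (by linarith)) (Icc_subset_Icc (by linarith) le_rfl)
  have hc := hl.continuousOn
  obtain ⟨z, -, ⟨_, ⟨r, hr, rfl⟩, hzr⟩, _, ⟨s, hs, rfl⟩, hzs⟩ :=
    hS.exists_metricProj_mem_both (isCompact_Icc.image_of_continuousOn hc)
      (isCompact_Icc.image_of_continuousOn (hc.mono hMsub))
      ((isCompact_Icc.union isCompact_Icc).image_of_continuousOn (hc.mono hNsub))
      (image_mono hMsub) (image_mono hNsub)
      (fun w hw => by
        obtain ⟨z, hz, hzw⟩ := mem_iUnion₂.1 hw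
        obtain ⟨r, hr, rfl⟩ := hzw.1
        by_cases hrab : r ∈ Ioo a b
        · exact Or.inl (mem_image_of_mem l (inside hz hr hzw (Ioo_subset_Icc_self hrab)))
        · exact Or.inr (mem_image_of_mem l (outside hz hr hzw hrab)))
      hx hy (mem_image_of_mem l (inside hx hpL hxp hp))
      (mem_image_of_mem l (outside hy hq hyq hqab)) hxp hyq
  have hthin := hX.thin l L hL hl r ⟨by linarith [hr.1], by linarith [hr.2]⟩ z hzr.2
  have htri := dist_triangle_left (l r) (l s) z
  rw [hzr.2, hzs.2, hl r (hMsub hr) s (hNsub hs)] at htri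
  rcases hs with hs | hs
  · linarith [le_abs_self (r - s), hr.1, hs.2]
  · linarith [neg_le_abs (r - s), hr.2, hs.1]

/-- Lemma 4.6, item 2: in an `(R,D)`-thin space, if a 1-Lipschitz curve
`α` starts projecting at `l(t)` and ends projecting at `l(u)`, with `t < u` both in
`(R, L-R)`, then `π_l(α)` contains a `3D`-net of `l([t,u])` or of
`l([R,t]) ∪ l([u,L-R])`. -/
theorem thin_proj_net_of_curve_two_interior_points
    {X : Type*} [MetricSpace X] {R D : ℝ} (hX : IsThinSpace X R D)
    {Lα : ℝ} (hLα : 0 ≤ Lα) {α : ℝ → X} (hα : LipschitzOnWith 1 α (Set.Icc 0 Lα))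
    {l : ℝ → X} {L : ℝ} (hL : 2 * R < L) (hl : IsSegmentOn l 0 L)
    {t u : ℝ} (ht : t ∈ Set.Ioo R (L - R)) (hu : u ∈ Set.Ioo R (L - R)) (htu : t < u)
    (hproj0 : l t ∈ metricProj (l '' Set.Icc 0 L) (α 0))
    (hproj1 : l u ∈ metricProj (l '' Set.Icc 0 L) (α Lα)) :
    ContainsNetOf (metricProjSet (l '' Set.Icc 0 L) (α '' Set.Icc 0 Lα))
        (l '' Set.Icc t u) (3 * D) ∨
      ContainsNetOf (metricProjSet (l '' Set.Icc 0 L) (α '' Set.Icc 0 Lα))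
        (l '' Set.Icc R t ∪ l '' Set.Icc u (L - R)) (3 * D) := by
  by_contra hnet
  simp only [ContainsNetOf, not_or, not_forall, not_exists, not_and, not_le, mem_union] at hnet
  obtain ⟨⟨_, ⟨v, hv, rfl⟩, hvfar⟩, _, hw, hwfar⟩ := hnet
  have hR := hX.R_pos
  have hS : IsPreconnected (α '' Icc 0 Lα) := isPreconnected_Icc.image α hα.continuousOn
  have h0 : α 0 ∈ α '' Icc 0 Lα := mem_image_of_mem α ⟨le_rfl, hLα⟩
  have h1 : α Lα ∈ α '' Icc 0 Lα := mem_image_of_mem α ⟨hLα, le_rfl⟩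
  have htL : t ∈ Icc 0 L := ⟨by linarith [ht.1], by linarith [ht.2]⟩
  have huL : u ∈ Icc 0 L := ⟨by linarith [hu.1], by linarith [hu.2]⟩
  rcases hw with ⟨w, hw, rfl⟩ | ⟨w, hw, rfl⟩
  · obtain ⟨z, hz, hle⟩ := hX.exists_dist_metricProjSet_le hS hL hl (a := w) (b := v)
      hw.1 (hv.2.trans hu.2.le) h0 h1 ⟨hw.2, hv.1⟩ huL (fun h => h.2.not_ge hv.2) hproj0 hproj1
    exact hle.elim (hwfar z hz).not_ge (hvfar z hz).not_ge
  · obtain ⟨z, hz, hle⟩ := hX.exists_dist_metricProjSet_le hS hL hl (a := v) (b := w)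
      (ht.1.le.trans hv.1) hw.2 h1 h0 ⟨hv.2, hw.1⟩ htL (fun h => h.1.not_ge hv.1) hproj1 hproj0
    exact hle.elim (hvfar z hz).not_ge (hwfar z hz).not_ge
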